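/- arXiv:math/0001035 — 6 statements merged into one kernel-verified Lean document; each statement's English description precedes it below -/
import Mathlib

section
/- The set of U-minimal rules satisfies the standard assumptions and is confluent. In particular, for every word w ∈ A*, every maximal sequence of elementary reductions of w using only U-minimal rules terminates at the shortlex normal form of π(w). -/
/-- The shortlex order on words: `u < v` iff `u` is shorter, or of equal length
and lexicographically smaller. -/
def ShortLexLt {A : Type} [LinearOrder A] (u v : List A) : Prop :=
  u.length < v.length ∨ (u.length = v.length ∧ List.Lex (· < ·) u v)

/-- An elementary `R`-reduction: replace an occurrence of a left-hand side of a rule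
of `R` as a subword by the corresponding right-hand side. -/
def ElemRed {A : Type} (R : Set (List A × List A)) (u v : List A) : Prop :=
  ∃ a b lam rho : List A, (lam, rho) ∈ R ∧ u = a ++ lam ++ b ∧ v = a ++ rho ++ b

/-- A word is `R`-irreducible if no elementary `R`-reduction applies to it. -/
def Irred {A : Type} (R : Set (List A × List A)) (u : List A) : Prop :=
  ¬ ∃ v : List A, ElemRed R u v

/-- The standard assumptions on a set of rules `R`: every rule `(u,v)` satisfies
`u > v` in shortlex and `π u = π v`, and Thue equivalence (the equivalence relation
generated by elementary `R`-reductions) coincides with equality of `π`-images. -/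
def StandardAssumptions {A G : Type} [LinearOrder A] (π : List A → G)
    (R : Set (List A × List A)) : Prop :=
  (∀ p ∈ R, ShortLexLt p.2 p.1 ∧ π p.1 = π p.2) ∧
  (∀ u v : List A, Relation.EqvGen (ElemRed R) u v ↔ π u = π v)

/-- `R` is confluent if all `R`-irreducible words obtainable from a given word by
sequences of elementary `R`-reductions are equal. -/
def Confluent {A : Type} (R : Set (List A × List A)) : Prop :=
  ∀ w u v : List A, Relation.ReflTransGen (ElemRed R) w u →
    Relation.ReflTransGen (ElemRed R) w v → Irred R u → Irred R v → u = v

/-- `u` is the shortlex normal form of its `π`-image: it is shortlex-least in its `π`-fiber. -/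
def IsShortLexNF {A G : Type} [LinearOrder A] (π : List A → G) (u : List A) : Prop :=
  ∀ v : List A, π v = π u → u = v ∨ ShortLexLt u v

/-- The universal set of rules: all pairs `(u,v)` with `u > v` in shortlex and `π u = π v`. -/
def URules {A G : Type} [LinearOrder A] (π : List A → G) : Set (List A × List A) :=
  {p | ShortLexLt p.2 p.1 ∧ π p.1 = π p.2}

/-- `s` is a proper (contiguous) subword of `u`. -/
def ProperFactor {A : Type} (s u : List A) : Prop :=
  ∃ a b : List A, u = a ++ s ++ b ∧ a ++ b ≠ []

/-- A rule `(u,v)` is `R`-minimal if `v` is `R`-irreducible and every proper subword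
of `u` is `R`-irreducible. -/
def RMinimal {A : Type} (R : Set (List A × List A)) (p : List A × List A) : Prop :=
  Irred R p.2 ∧ ∀ s : List A, ProperFactor s p.1 → Irred R s

/-- The set of `U`-minimal rules. -/
def UMinRules {A G : Type} [LinearOrder A] (π : List A → G) : Set (List A × List A) :=
  {p | p ∈ URules π ∧ RMinimal (URules π) p}

theorem shortLexLt_iff_shortlex {A : Type} [LinearOrder A] {u v : List A} :
    ShortLexLt u v ↔ List.Shortlex (· < ·) u v :=
  List.shortlex_def.symm

theorem wellFounded_shortLexLt {A : Type} [LinearOrder A] [WellFoundedLT A] :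
    WellFounded (ShortLexLt : List A → List A → Prop) := by
  have h : (ShortLexLt : List A → List A → Prop) = List.Shortlex (· < ·) := by
    ext u v
    exact shortLexLt_iff_shortlex
  rw [h]
  exact List.Shortlex.wf wellFounded_lt

theorem ShortLexLt.asymm {A : Type} [LinearOrder A] {u v : List A} (h : ShortLexLt u v) :
    ¬ ShortLexLt v u := by
  rw [shortLexLt_iff_shortlex] at h ⊢
  exact _root_.asymm h

theorem ShortLexLt.irrefl {A : Type} [LinearOrder A] (u : List A) : ¬ ShortLexLt u u :=
  fun h => h.asymm h

theorem ShortLexLt.trichotomous {A : Type} [LinearOrder A] (u v : List A) :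
    ShortLexLt u v ∨ u = v ∨ ShortLexLt v u := by
  simp only [shortLexLt_iff_shortlex]
  exact trichotomous_of (List.Shortlex (· < ·)) u v

theorem List.Lex.append_of_length_eq {A : Type} {r : A → A → Prop} {u v : List A}
    (h : List.Lex r u v) (hlen : u.length = v.length) (b : List A) :
    List.Lex r (u ++ b) (v ++ b) := by
  induction h with
  | nil => simp at hlen
  | rel h => exact .rel h
  | cons _ ih => exact .cons (ih (by simpa using hlen))

theorem ShortLexLt.append {A : Type} [LinearOrder A] {u v : List A} (h : ShortLexLt u v)
    (a b : List A) : ShortLexLt (a ++ u ++ b) (a ++ v ++ b) := by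
  rcases h with h | ⟨hlen, h⟩
  · exact .inl (by simpa using h)
  · exact .inr ⟨by simp [hlen], (h.append_left _ a).append_of_length_eq (by simp [hlen]) b⟩

theorem ElemRed.append {A : Type} {R : Set (List A × List A)} {u v : List A}
    (h : ElemRed R u v) (a b : List A) : ElemRed R (a ++ u ++ b) (a ++ v ++ b) := by
  obtain ⟨c, d, l, r, hR, rfl, rfl⟩ := h
  exact ⟨a ++ c, d ++ b, l, r, hR, by simp, by simp⟩

theorem ElemRed.of_mem {A : Type} {R : Set (List A × List A)} {u v : List A}
    (h : (u, v) ∈ R) : ElemRed R u v :=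
  ⟨[], [], u, v, h, by simp, by simp⟩

theorem ElemRed.mono {A : Type} {R S : Set (List A × List A)} (hRS : R ⊆ S) {u v : List A}
    (h : ElemRed R u v) : ElemRed S u v := by
  obtain ⟨a, b, l, r, hR, hu, hv⟩ := h
  exact ⟨a, b, l, r, hRS hR, hu, hv⟩

theorem uMinRules_subset_uRules {A G : Type} [LinearOrder A] (π : List A → G) :
    UMinRules π ⊆ URules π :=
  fun _ h => h.1

theorem elemRed_uRules {A G : Type} [LinearOrder A] [Mul G] {π : List A → G}
    (hπ_mul : ∀ u v : List A, π (u ++ v) = π u * π v) {u v : List A}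
    (h : ElemRed (URules π) u v) : ShortLexLt v u ∧ π u = π v := by
  obtain ⟨a, b, l, r, ⟨hlt, heq⟩, rfl, rfl⟩ := h
  refine ⟨hlt.append a b, ?_⟩
  simp only at heq
  simp [hπ_mul, heq]

theorem irred_uRules_iff {A G : Type} [LinearOrder A] [Mul G] {π : List A → G}
    (hπ_mul : ∀ u v : List A, π (u ++ v) = π u * π v) {u : List A} :
    Irred (URules π) u ↔ IsShortLexNF π u := by
  constructor
  · intro h v hv
    rcases ShortLexLt.trichotomous u v with huv | huv | huv
    · exact .inr huv
    · exact .inl huv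
    · exact (h ⟨v, .of_mem ⟨huv, hv.symm⟩⟩).elim
  · rintro h ⟨v, hv⟩
    obtain ⟨hlt, heq⟩ := elemRed_uRules hπ_mul hv
    rcases h v heq.symm with rfl | huv
    · exact hlt.irrefl
    · exact hlt.asymm huv

theorem exists_isShortLexNF {A G : Type} [LinearOrder A] [WellFoundedLT A] (π : List A → G)
    (w : List A) : ∃ u, π u = π w ∧ IsShortLexNF π u := by
  obtain ⟨u, hu, hmin⟩ := wellFounded_shortLexLt.has_min {u | π u = π w} ⟨w, rfl⟩
  refine ⟨u, hu, fun v hv => ?_⟩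
  rcases ShortLexLt.trichotomous u v with h | h | h
  · exact .inr h
  · exact .inl h
  · exact (hmin v (hv.trans hu) h).elim

theorem IsShortLexNF.eq {A G : Type} [LinearOrder A] {π : List A → G} {u v : List A}
    (hu : IsShortLexNF π u) (hv : IsShortLexNF π v) (h : π u = π v) : u = v := by
  rcases hu v h.symm with h1 | h1
  · exact h1
  · rcases hv u h with h2 | h2
    · exact h2.symm
    · exact (h1.asymm h2).elim

/-- A word that is reducible by some rule of `U` is already reducible by a `U`-minimal rule. -/
theorem irred_uRules_of_irred_uMinRules {A G : Type} [LinearOrder A] [WellFoundedLT A] [Mul G]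
    {π : List A → G} (hπ_mul : ∀ u v : List A, π (u ++ v) = π u * π v) {u : List A}
    (h : Irred (UMinRules π) u) : Irred (URules π) u := by
  induction hn : u.length using Nat.strong_induction_on generalizing u with
  | _ n ih =>
  subst hn
  by_contra hred
  obtain ⟨v, hvu, hv⟩ := exists_isShortLexNF π u
  have hlt : ShortLexLt v u := by
    rcases hv u hvu.symm with rfl | hlt
    · exact (hred ((irred_uRules_iff hπ_mul).2 hv)).elim
    · exact hlt
  refine h ⟨v, .of_mem ⟨⟨hlt, hvu.symm⟩, (irred_uRules_iff hπ_mul).2 hv, ?_⟩⟩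
  rintro s ⟨a, b, rfl, hab⟩
  refine ih s.length ?_ (fun ⟨t, ht⟩ => h ⟨_, ht.append a b⟩) rfl
  have := List.length_pos_of_ne_nil hab
  simp only [List.length_append] at this ⊢
  omega

theorem Relation.ReflTransGen.toEqvGen {α : Type} {r : α → α → Prop} {a b : α}
    (h : Relation.ReflTransGen r a b) : Relation.EqvGen r a b := by
  induction h with
  | refl => exact .refl _
  | tail _ h ih => exact .trans _ _ _ ih (.rel _ _ h)

theorem exists_irred_of_elemRed_lt {A : Type} [LinearOrder A] [WellFoundedLT A]
    {R : Set (List A × List A)} (hR : ∀ u v, ElemRed R u v → ShortLexLt v u) (w : List A) :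
    ∃ u, Relation.ReflTransGen (ElemRed R) w u ∧ Irred R u := by
  induction w using (wellFounded_shortLexLt (A := A)).induction with
  | _ w ih =>
  by_cases h : Irred R w
  · exact ⟨w, .refl, h⟩
  · obtain ⟨v, hv⟩ := not_not.1 h
    obtain ⟨u, hu, hirr⟩ := ih v (hR _ _ hv)
    exact ⟨u, .head hv hu, hirr⟩

/-- The set of `U`-minimal rules satisfies the standard assumptions and is
confluent; in particular every maximal sequence of elementary reductions by `U`-minimal rules
of any word `w` terminates, and terminates at the shortlex normal form of `π w`. -/
theorem stmt4 {A G : Type} [Fintype A] [LinearOrder A] [Group G]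
    (π : List A → G) (hπ_nil : π [] = 1)
    (hπ_mul : ∀ u v : List A, π (u ++ v) = π u * π v)
    (hπ_surj : Function.Surjective π)
    (ι : A → A) (hι : Function.Involutive ι)
    (hι_inv : ∀ x : A, π [ι x] = (π [x])⁻¹) :
    StandardAssumptions π (UMinRules π) ∧ Confluent (UMinRules π) ∧
    (∀ w : List A, ∃ u : List A,
      Relation.ReflTransGen (ElemRed (UMinRules π)) w u ∧ Irred (UMinRules π) u) ∧
    (∀ w u : List A, Relation.ReflTransGen (ElemRed (UMinRules π)) w u →
      Irred (UMinRules π) u → π u = π w ∧ IsShortLexNF π u) := by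
  have hred : ∀ u v, ElemRed (UMinRules π) u v → ShortLexLt v u ∧ π u = π v :=
    fun u v h => elemRed_uRules hπ_mul (h.mono (uMinRules_subset_uRules π))
  have heqv : ∀ u v, Relation.EqvGen (ElemRed (UMinRules π)) u v → π u = π v := by
    intro u v h
    induction h with
    | rel _ _ h => exact (hred _ _ h).2
    | refl => rfl
    | symm _ _ _ ih => exact ih.symm
    | trans _ _ _ _ _ ih₁ ih₂ => exact ih₁.trans ih₂
  have hex := exists_irred_of_elemRed_lt fun u v h => (hred u v h).1
  have hnf : ∀ w u : List A, Relation.ReflTransGen (ElemRed (UMinRules π)) w u →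
      Irred (UMinRules π) u → π u = π w ∧ IsShortLexNF π u := fun w u h hirr =>
    ⟨(heqv _ _ h.toEqvGen).symm,
      (irred_uRules_iff hπ_mul).1 (irred_uRules_of_irred_uMinRules hπ_mul hirr)⟩
  refine ⟨⟨fun p hp => hp.1, fun u v => ⟨heqv u v, fun h => ?_⟩⟩, ?_, hex, hnf⟩
  · obtain ⟨u', hu, hu_irr⟩ := hex u
    obtain ⟨v', hv, hv_irr⟩ := hex v
    obtain ⟨hu_eq, hu_nf⟩ := hnf _ _ hu hu_irr
    obtain ⟨hv_eq, hv_nf⟩ := hnf _ _ hv hv_irr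
    obtain rfl := hu_nf.eq hv_nf (by rw [hu_eq, hv_eq, h])
    exact .trans _ _ _ hu.toEqvGen (.symm _ _ hv.toEqvGen)
  · intro w u v hu hv hu_irr hv_irr
    obtain ⟨hu_eq, hu_nf⟩ := hnf _ _ hu hu_irr
    obtain ⟨hv_eq, hv_nf⟩ := hnf _ _ hv hv_irr
    exact hu_nf.eq hv_nf (hu_eq.trans hv_eq.symm)
end

section
/- Let (u,v) be a U-minimal rule, and write u = u₁⋯u_{n+r} and v = v₁⋯v_n with all uᵢ, vⱼ ∈ A and n ≥ 0, r = |u| − |v|. Then: 0 ≤ r ≤ 2; if n > 0 then u₁ ≠ v₁ and u_{n+r} ≠ v_n; if r = 0 and n > 0 then u₁ > v₁ in the order on A; if r = 2 and n > 0 then u₁ < v₁ and u₂ < ι(u₁); and if r = 2 and n = 0 then u₁ ≤ ι(u₂) and u₂ ≤ ι(u₁). -/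
theorem Irred.not_shortLexLt {A G : Type} [LinearOrder A] {π : List A → G} {u v : List A}
    (hu : Irred (URules π) u) (hπ : π u = π v) : ¬ ShortLexLt v u :=
  fun hlt => hu ⟨v, [], [], u, v, ⟨hlt, hπ⟩, by simp, by simp⟩

theorem shortLexLt_cons_iff {A : Type} [LinearOrder A] {x : A} {u v : List A} :
    ShortLexLt (x :: u) (x :: v) ↔ ShortLexLt u v := by
  simp [ShortLexLt, List.lex_cons_iff]

theorem List.Lex.of_append_right {A : Type} [LinearOrder A] {w : List A} :
    ∀ {u v : List A}, u.length = v.length →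
      List.Lex (· < ·) (u ++ w) (v ++ w) → List.Lex (· < ·) u v
  | [], [], _, h => absurd h (irrefl_of (List.Lex (· < ·)) w)
  | _ :: u, _ :: v, hl, h => by
    cases h with
    | cons h => exact .cons (List.Lex.of_append_right (by simpa using hl) h)
    | rel h => exact .rel h

theorem ShortLexLt.of_append_right {A : Type} [LinearOrder A] {u v w : List A}
    (h : ShortLexLt (u ++ w) (v ++ w)) : ShortLexLt u v := by
  rcases h with h | ⟨hl, h⟩
  · exact Or.inl (by simpa using h)
  · have hl' : u.length = v.length := by simpa using hl
    exact Or.inr ⟨hl', h.of_append_right hl'⟩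

theorem shortLexLt_cons_of_lt {A : Type} [LinearOrder A] {x y : A} {u v : List A}
    (hl : u.length = v.length) (h : x < y) : ShortLexLt (x :: u) (y :: v) :=
  Or.inr ⟨by simp [hl], .rel h⟩

/-- Length and letter conditions satisfied by a `U`-minimal rule `(u,v)`,
where `r = |u| - |v|` and `n = |v|`. -/
theorem stmt5 {A G : Type} [Fintype A] [LinearOrder A] [Group G]
    (π : List A → G) (hπ_nil : π [] = 1)
    (hπ_mul : ∀ u v : List A, π (u ++ v) = π u * π v)
    (hπ_surj : Function.Surjective π)
    (ι : A → A) (hι : Function.Involutive ι)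
    (hι_inv : ∀ x : A, π [ι x] = (π [x])⁻¹)
    (u v : List A) (h : (u, v) ∈ UMinRules π) :
    -- 0 ≤ r ≤ 2
    (v.length ≤ u.length ∧ u.length ≤ v.length + 2) ∧
    -- if n > 0 then u₁ ≠ v₁
    (∀ (x y : A) (xs ys : List A), u = x :: xs → v = y :: ys → x ≠ y) ∧
    -- if n > 0 then u_{n+r} ≠ v_n
    (∀ x y : A, u.getLast? = some x → v.getLast? = some y → x ≠ y) ∧
    -- if r = 0 and n > 0 then u₁ > v₁
    (u.length = v.length →
      ∀ (x y : A) (xs ys : List A), u = x :: xs → v = y :: ys → y < x) ∧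
    -- if r = 2 and n > 0 then u₁ < v₁ and u₂ < ι(u₁)
    (u.length = v.length + 2 →
      ∀ (x₁ x₂ y : A) (xs ys : List A), u = x₁ :: x₂ :: xs → v = y :: ys →
        x₁ < y ∧ x₂ < ι x₁) ∧
    -- if r = 2 and n = 0 then u₁ ≤ ι(u₂) and u₂ ≤ ι(u₁)
    (v = [] → ∀ x₁ x₂ : A, u = [x₁, x₂] → x₁ ≤ ι x₂ ∧ x₂ ≤ ι x₁) := by
  obtain ⟨⟨hlt, hπuv⟩, -, hirr⟩ := h
  replace hlt : ShortLexLt v u := hlt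
  replace hπuv : π u = π v := hπuv
  have hcons (x : A) (xs : List A) : π (x :: xs) = π [x] * π xs := hπ_mul [x] xs
  have tail_irred {x : A} {xs : List A} (hu : u = x :: xs) : Irred (URules π) xs :=
    hirr xs ⟨[x], [], by simp [hu], by simp⟩
  have init_irred {x : A} {xs : List A} (hu : u = xs ++ [x]) : Irred (URules π) xs :=
    hirr xs ⟨[], [x], by simp [hu], by simp⟩
  have tail_eq {x : A} {xs : List A} (hu : u = x :: xs) : π xs = π (ι x :: v) := by
    rw [hcons, hι_inv, ← hπuv, hu, hcons x xs, inv_mul_cancel_left]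
  have init_eq {x : A} {xs : List A} (hu : u = xs ++ [x]) : π xs = π (v ++ [ι x]) := by
    rw [hπ_mul, hι_inv, ← hπuv, hu, hπ_mul, mul_inv_cancel_right]
  have head_ne : ∀ (x y : A) (xs ys : List A), u = x :: xs → v = y :: ys → x ≠ y := by
    rintro x _ xs ys hu hv rfl
    refine (tail_irred hu).not_shortLexLt (v := ys) ?_ ?_
    · rw [hu, hv, hcons, hcons x ys] at hπuv
      exact mul_left_cancel hπuv
    · rwa [hu, hv, shortLexLt_cons_iff] at hlt
  refine ⟨⟨?_, ?_⟩, head_ne, ?_, ?_, ?_, ?_⟩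
  · exact hlt.elim le_of_lt fun h => h.1.le
  · rcases hu : u with _ | ⟨x, xs⟩
    · simp
    · by_contra hlen
      refine (tail_irred hu).not_shortLexLt (tail_eq hu) (Or.inl ?_)
      simp only [List.length_cons] at hlen ⊢
      omega
  · rintro x _ hx hy rfl
    obtain ⟨xs, hu⟩ := List.getLast?_eq_some_iff.mp hx
    obtain ⟨ys, hv⟩ := List.getLast?_eq_some_iff.mp hy
    refine (init_irred hu).not_shortLexLt (v := ys) ?_ ?_
    · rw [hu, hv, hπ_mul, hπ_mul] at hπuv
      exact mul_right_cancel hπuv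
    · rw [hu, hv] at hlt
      exact hlt.of_append_right
  · intro hlen x y xs ys hu hv
    rcases hlt with h | ⟨-, h⟩
    · omega
    · rw [hu, hv] at h
      cases h with
      | rel h => exact h
      | cons => exact absurd rfl (head_ne _ _ _ _ hu hv)
  · intro hlen x₁ x₂ y xs ys hu hv
    have hlen' : xs.length = ys.length + 1 := by simpa [hu, hv] using hlen
    constructor
    · refine lt_of_le_of_ne (not_lt.mp fun hyx => ?_) (head_ne _ _ _ _ hu hv)
      obtain ⟨zs, z, rfl⟩ := (List.eq_nil_or_concat' xs).resolve_left
        (by rintro rfl; simp at hlen')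
      have hu' : u = (x₁ :: x₂ :: zs) ++ [z] := by simp [hu]
      refine (init_irred hu').not_shortLexLt (init_eq hu') ?_
      rw [hv, List.cons_append]
      exact shortLexLt_cons_of_lt (by simpa using hlen'.symm) hyx
    · refine lt_of_le_of_ne (not_lt.mp fun hlt' => ?_) ?_
      · exact (tail_irred hu).not_shortLexLt (tail_eq hu)
          (shortLexLt_cons_of_lt (by simp [hv, hlen']) hlt')
      · rintro rfl
        have hpre : Irred (URules π) [x₁, ι x₁] :=
          hirr _ ⟨[], xs, by simp [hu], by rintro rfl; simp at hlen'⟩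
        exact hpre.not_shortLexLt (v := []) (by rw [hcons, hι_inv, hπ_nil, mul_inv_cancel])
          (Or.inl (by simp))
  · rintro rfl x₁ x₂ hu
    have hu' : u = [x₁] ++ [x₂] := hu
    exact ⟨not_lt.mp fun h => (init_irred hu').not_shortLexLt (init_eq hu')
        (shortLexLt_cons_of_lt rfl h),
      not_lt.mp fun h => (tail_irred hu).not_shortLexLt (tail_eq hu)
        (shortLexLt_cons_of_lt rfl h)⟩
end

section
/- Let A be a finite alphabet and L ⊆ A* a nonempty regular language. Let φ : A* → F(A) be the canonical monoid homomorphism into the free group F(A) on A, sending each letter to the corresponding generator. Then the language L' = {w ∈ A* : there exist k ≥ 0 and words w₁, …, w_{2k+1} ∈ L such that φ(w) = φ(w₁)·φ(w₂)⁻¹·φ(w₃)⋯φ(w_{2k})⁻¹·φ(w_{2k+1}) in F(A)} is a regular language over A. -/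
/-- The canonical monoid homomorphism `A* → F(A)` sending each letter to the corresponding
free generator. -/
def toFreeGroup {A : Type} (w : List A) : FreeGroup A :=
  (w.map FreeGroup.of).prod

/-- The alternating products `φ(w₁)·φ(w₂)⁻¹·⋯·φ(w₂ₖ₊₁)` of words of `L`. -/
inductive AlternatingProduct {A : Type} (L : Language A) : FreeGroup A → Prop
  | base {u : List A} (hu : u ∈ L) : AlternatingProduct L (toFreeGroup u)
  | step {u v : List A} {x : FreeGroup A} (hu : u ∈ L) (hv : v ∈ L)
      (hx : AlternatingProduct L x) :
      AlternatingProduct L (toFreeGroup u * ((toFreeGroup v)⁻¹ * x))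

theorem toFreeGroup_append {A : Type} (u v : List A) :
    toFreeGroup (u ++ v) = toFreeGroup u * toFreeGroup v := by
  simp [toFreeGroup]

theorem toFreeGroup_eq_mk {A : Type} (w : List A) :
    toFreeGroup w = FreeGroup.mk (w.map fun a => (a, true)) := by
  induction w with
  | nil => rfl
  | cons a w ih =>
    have h : toFreeGroup (a :: w) = FreeGroup.of a * toFreeGroup w := by simp [toFreeGroup]
    rw [h, ih, FreeGroup.of, FreeGroup.mul_mk]
    rfl

theorem prod_ofFn_alternating_add_two {A : Type} (n : ℕ) (ws : Fin (n + 2) → List A) :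
    (List.ofFn fun i : Fin (n + 2) =>
      if Even (i : ℕ) then toFreeGroup (ws i) else (toFreeGroup (ws i))⁻¹).prod =
    toFreeGroup (ws 0) * ((toFreeGroup (ws 1))⁻¹ * (List.ofFn fun i : Fin n =>
      if Even (i : ℕ) then toFreeGroup (ws i.succ.succ)
      else (toFreeGroup (ws i.succ.succ))⁻¹).prod) := by
  rw [List.ofFn_succ, List.ofFn_succ]
  simp [Nat.even_add_one, -Nat.not_even_iff_odd]

theorem alternatingProduct_iff_exists_ofFn {A : Type} (L : Language A) (x : FreeGroup A) :
    AlternatingProduct L x ↔ ∃ (k : ℕ) (ws : Fin (2 * k + 1) → List A), (∀ i, ws i ∈ L) ∧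
      x = (List.ofFn fun i : Fin (2 * k + 1) =>
        if Even (i : ℕ) then toFreeGroup (ws i) else (toFreeGroup (ws i))⁻¹).prod := by
  constructor
  · intro h
    induction h with
    | @base u hu => exact ⟨0, fun _ => u, fun _ => hu, by simp⟩
    | @step u v x hu hv _ ih =>
      obtain ⟨k, ws, hws, rfl⟩ := ih
      refine ⟨k + 1, (Fin.cons u (Fin.cons v ws : Fin (2 * k + 1 + 1) → List A) :
        Fin (2 * k + 1 + 1 + 1) → List A), ?_, ?_⟩
      · exact Fin.cases hu (Fin.cases hv hws)
      · exact (prod_ofFn_alternating_add_two (2 * k + 1)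
          (Fin.cons u (Fin.cons v ws : Fin (2 * k + 1 + 1) → List A))).symm
  · rintro ⟨k, ws, hws, rfl⟩
    induction k with
    | zero => simpa using AlternatingProduct.base (hws 0)
    | succ k ih =>
      refine (prod_ofFn_alternating_add_two (2 * k + 1) ws).symm ▸ ?_
      exact .step (hws _) (hws _) (ih _ fun _ => hws _)

/-- The left stabilizer of the set of alternating products of words of `L`. -/
def alternatingStabilizer {A : Type} (L : Language A) : Subgroup (FreeGroup A) where
  carrier := {h | ∀ x, AlternatingProduct L (h * x) ↔ AlternatingProduct L x}
  one_mem' := by simp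
  mul_mem' := by
    intro a b ha hb x
    rw [mul_assoc, ha, hb]
  inv_mem' := by
    intro a ha x
    rw [← ha, mul_inv_cancel_left]

theorem mul_inv_mem_alternatingStabilizer {A : Type} {L : Language A} {u v : List A}
    (hu : u ∈ L) (hv : v ∈ L) :
    toFreeGroup u * (toFreeGroup v)⁻¹ ∈ alternatingStabilizer L := by
  intro x
  refine ⟨fun h => ?_, fun h => ?_⟩
  · simpa [mul_assoc] using AlternatingProduct.step hv hu h
  · simpa [mul_assoc] using AlternatingProduct.step hu hv h

/-- The translates, by the left stabilizer of the alternating products, of the prefixes of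
words of `L`. -/
def alternatingCore {A : Type} (L : Language A) : Set (FreeGroup A) :=
  {x | ∃ u v : List A, u ++ v ∈ L ∧ x * (toFreeGroup u)⁻¹ ∈ alternatingStabilizer L}

theorem mul_mem_alternatingCore {A : Type} {L : Language A} {h x : FreeGroup A}
    (hh : h ∈ alternatingStabilizer L) (hx : x ∈ alternatingCore L) :
    h * x ∈ alternatingCore L := by
  obtain ⟨u, v, huv, hx⟩ := hx
  exact ⟨u, v, huv, by simpa [mul_assoc] using mul_mem hh hx⟩

theorem toFreeGroup_mem_alternatingCore {A : Type} {L : Language A} {u v : List A}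
    (h : u ++ v ∈ L) : toFreeGroup u ∈ alternatingCore L :=
  ⟨u, v, h, by simp [one_mem]⟩

theorem mk_mem_of_append_eq_map {A : Type} {L : Language A} {u : List A} (hu : u ∈ L)
    {p q : List (A × Bool)} (h : p ++ q = u.map fun a => (a, true)) :
    FreeGroup.mk p ∈ alternatingCore L := by
  obtain ⟨s, t, rfl, rfl, rfl⟩ := List.map_eq_append_iff.1 h.symm
  rw [← toFreeGroup_eq_mk]
  exact toFreeGroup_mem_alternatingCore hu

/-- Every alternating product is represented by a word all of whose prefixes lie in the core. -/
theorem AlternatingProduct.exists_mk_eq {A : Type} {L : Language A} {x : FreeGroup A}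
    (hx : AlternatingProduct L x) : ∃ W : List (A × Bool), FreeGroup.mk W = x ∧
      ∀ p q, p ++ q = W → FreeGroup.mk p ∈ alternatingCore L := by
  induction hx with
  | @base u hu => exact ⟨_, (toFreeGroup_eq_mk u).symm, fun _ _ => mk_mem_of_append_eq_map hu⟩
  | @step u v x hu hv _ ih =>
    obtain ⟨W, rfl, hW⟩ := ih
    refine ⟨u.map (fun a => (a, true)) ++ (FreeGroup.invRev (v.map fun a => (a, true)) ++ W),
      ?_, ?_⟩
    · rw [← FreeGroup.mul_mk, ← FreeGroup.mul_mk, ← FreeGroup.inv_mk, ← toFreeGroup_eq_mk,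
        ← toFreeGroup_eq_mk]
    · intro p q hpq
      have huv := mul_inv_mem_alternatingStabilizer hu hv
      rcases List.append_eq_append_iff.1 hpq with ⟨p', hp, -⟩ | ⟨r, rfl, hr⟩
      · exact mk_mem_of_append_eq_map hu hp.symm
      rw [← FreeGroup.mul_mk, ← toFreeGroup_eq_mk]
      rcases List.append_eq_append_iff.1 hr.symm with ⟨s, hs, -⟩ | ⟨s, rfl, hs⟩
      · have hs' := congrArg FreeGroup.invRev hs
        rw [FreeGroup.invRev_invRev, FreeGroup.invRev_append] at hs'
        have hm := mul_mem_alternatingCore huv (mk_mem_of_append_eq_map hv hs'.symm)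
        have hv' : toFreeGroup v = FreeGroup.mk (FreeGroup.invRev s) * (FreeGroup.mk r)⁻¹ := by
          rw [toFreeGroup_eq_mk, hs', FreeGroup.inv_mk, FreeGroup.mul_mk]
        rwa [hv', mul_inv_rev, inv_inv, mul_assoc, mul_assoc, inv_mul_cancel, mul_one] at hm
      · rw [← FreeGroup.mul_mk, ← FreeGroup.inv_mk, ← toFreeGroup_eq_mk, ← mul_assoc]
        exact mul_mem_alternatingCore huv (hW s q hs.symm)

theorem FreeGroup.Red.forall_append_mk_mem {A : Type} {S : Set (FreeGroup A)}
    {W W' : List (A × Bool)} (h : FreeGroup.Red W W')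
    (hW : ∀ p q, p ++ q = W → FreeGroup.mk p ∈ S) :
    ∀ p q, p ++ q = W' → FreeGroup.mk p ∈ S := by
  induction h with
  | refl => exact hW
  | tail _ hstep ih =>
    obtain @⟨L₁, L₂, a, b⟩ := hstep
    intro p q hpq
    rcases List.append_eq_append_iff.1 hpq with ⟨r, hr, -⟩ | ⟨r, rfl, hr⟩
    · exact ih p (r ++ (a, b) :: (a, !b) :: L₂) (by simp [hr])
    · have h := ih (L₁ ++ (a, b) :: (a, !b) :: r) q (by simp [hr])
      have hs : FreeGroup.mk (L₁ ++ (a, b) :: (a, !b) :: r) = FreeGroup.mk (L₁ ++ r) :=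
        Quot.sound FreeGroup.Red.Step.not
      rwa [hs] at h

theorem FreeGroup.isReduced_map_true {A : Type} (w : List A) :
    FreeGroup.IsReduced (w.map fun a => (a, true)) := by
  rw [FreeGroup.IsReduced, List.isChain_map]
  exact (List.pairwise_of_forall fun _ _ _ => rfl).isChain

theorem AlternatingProduct.mem_alternatingCore_of_append {A : Type} {L : Language A}
    {p q : List A} (h : AlternatingProduct L (toFreeGroup (p ++ q))) :
    toFreeGroup p ∈ alternatingCore L := by
  classical
  obtain ⟨W, hW, hmem⟩ := h.exists_mk_eq
  rw [toFreeGroup_eq_mk] at hW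
  have hred : FreeGroup.Red W ((p ++ q).map fun a => (a, true)) := by
    rw [← (FreeGroup.isReduced_map_true (p ++ q)).reduce_eq, ← FreeGroup.reduce.sound hW]
    exact FreeGroup.reduce.red
  rw [toFreeGroup_eq_mk]
  exact hred.forall_append_mk_mem hmem _ (q.map fun a => (a, true)) (by simp)

/-- For a nonempty regular language `L ⊆ A*`, the language of words `w`
whose image in the free group equals an alternating product
`φ(w₁)·φ(w₂)⁻¹·⋯·φ(w₂ₖ)⁻¹·φ(w₂ₖ₊₁)` of elements of `L` is regular. -/
theorem stmt10 {A : Type} [Fintype A] (L : Language A)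
    (hreg : L.IsRegular) (hne : ∃ w : List A, w ∈ L) :
    Language.IsRegular {w : List A | ∃ (k : ℕ) (ws : Fin (2 * k + 1) → List A),
      (∀ i, ws i ∈ L) ∧
      toFreeGroup w = (List.ofFn fun i : Fin (2 * k + 1) =>
        if Even (i : ℕ) then toFreeGroup (ws i) else (toFreeGroup (ws i))⁻¹).prod} := by
  simp_rw [← alternatingProduct_iff_exists_ofFn]
  rw [Language.isRegular_iff_finite_range_leftQuotient] at hreg
  refine Language.isRegular_iff_finite_range_leftQuotient.2 ?_
  let F (Q : Language A) : Language A := {y | ∃ u v, L.leftQuotient u = Q ∧ v ∈ Q ∧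
    AlternatingProduct L (toFreeGroup (u ++ y))}
  refine ((hreg.image F).insert (∅ : Set (List A))).subset ?_
  rintro _ ⟨p, rfl⟩
  by_cases hp : ∃ y, AlternatingProduct L (toFreeGroup (p ++ y))
  · right
    obtain ⟨y, hy⟩ := hp
    obtain ⟨u, v, huv, hpu⟩ := hy.mem_alternatingCore_of_append
    refine ⟨_, ⟨u, rfl⟩, Set.ext fun z => ?_⟩
    have key : AlternatingProduct L (toFreeGroup (p ++ z)) ↔
        AlternatingProduct L (toFreeGroup (u ++ z)) := by
      rw [← hpu (toFreeGroup (u ++ z))]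
      simp [toFreeGroup_append, mul_assoc]
    refine Iff.trans ?_ key.symm
    refine ⟨?_, fun h => ⟨u, v, rfl, huv, h⟩⟩
    rintro ⟨u', v', hu', hv', h⟩
    have hv'' : u' ++ v' ∈ L := by
      rw [← hu'] at hv'
      exact hv'
    rw [← mul_inv_mem_alternatingStabilizer hv'' hv' (toFreeGroup (u ++ z))]
    simpa [toFreeGroup_append, mul_assoc] using h
  · left
    exact Set.eq_empty_of_forall_notMem fun y hy => hp ⟨y, hy⟩
end

section
/- Let M be a finite state automaton (allowing ε-transitions, multiple initial states and multiple final states) over the alphabet A⁺ × A⁺ with nonempty sets of initial and final states, and let φ be a function from the states of M to G such that: φ(s) = 1 for every initial or final state s; for every arrow from s to t labelled (x,y) ∈ A⁺ × A⁺ one has φ(t) = π⁺(x)⁻¹ · φ(s) · π⁺(y); and φ(s) = φ(t) for every ε-arrow from s to t. Then every pair (u,v) ∈ A* × A* whose padded word (u,v)⁺ is accepted by M satisfies π(u) = π(v) in G. -/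
/-- The padded word over `A⁺ × A⁺` (with `A⁺ = Option A`, `none` the padding symbol `$`)
associated to a pair of words `(u, v)`. -/
def padPair {A : Type} (p : List A × List A) : List (Option A × Option A) :=
  List.zip (p.1.map some ++ List.replicate (p.2.length - p.1.length) none)
           (p.2.map some ++ List.replicate (p.1.length - p.2.length) none)

/-- The extension `π⁺ : A⁺ → G` of `π` to the padded alphabet, sending `$` to `1`. -/
def extendPad {A G : Type} [One G] (π : List A → G) : Option A → G
  | none => 1
  | some a => π [a]

/-- Paths in a finite state automaton over the alphabet `A⁺ × A⁺`, allowing ε-arrows (given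
by the relation `eps`) and labelled arrows (given by the relation `lab`).
`EpsPath lab eps s w t` means there is a path of arrows from `s` to `t` whose labels
(ignoring ε-labels) spell out `w`. -/
inductive EpsPath {A σ : Type} (lab : σ → (Option A × Option A) → σ → Prop)
    (eps : σ → σ → Prop) : σ → List (Option A × Option A) → σ → Prop
  | nil (s : σ) : EpsPath lab eps s [] s
  | cons_lab {s t u : σ} {x : Option A × Option A} {w : List (Option A × Option A)} :
      lab s x t → EpsPath lab eps t w u → EpsPath lab eps s (x :: w) u
  | cons_eps {s t u : σ} {w : List (Option A × Option A)} :
      eps s t → EpsPath lab eps t w u → EpsPath lab eps s w u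

theorem EpsPath.map_eq {A σ G : Type} [Group G] {f : Option A → G}
    {lab : σ → (Option A × Option A) → σ → Prop} {eps : σ → σ → Prop} {φ : σ → G}
    (hlab : ∀ (s t : σ) (x y : Option A), lab s (x, y) t → φ t = (f x)⁻¹ * φ s * f y)
    (heps : ∀ s t : σ, eps s t → φ s = φ t)
    {s t : σ} {w : List (Option A × Option A)} (h : EpsPath lab eps s w t) :
    φ t = (((w.map Prod.fst).map f).prod)⁻¹ * φ s * ((w.map Prod.snd).map f).prod := by
  induction h with
  | nil s => simp
  | @cons_lab s t u x w hx _ ih =>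
    rw [ih, hlab s t x.1 x.2 hx]
    simp [mul_assoc]
  | cons_eps he _ ih => rw [ih, heps _ _ he]

theorem padPair_map_fst {A : Type} (u v : List A) :
    (padPair (u, v)).map Prod.fst =
      u.map some ++ List.replicate (v.length - u.length) none := by
  apply List.map_fst_zip
  simp only [List.length_append, List.length_map, List.length_replicate]
  omega

theorem padPair_map_snd {A : Type} (u v : List A) :
    (padPair (u, v)).map Prod.snd =
      v.map some ++ List.replicate (u.length - v.length) none := by
  apply List.map_snd_zip
  simp only [List.length_append, List.length_map, List.length_replicate]
  omega

theorem prod_map_extendPad {A G : Type} [Group G] {π : List A → G} (hπ_nil : π [] = 1)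
    (hπ_mul : ∀ u v : List A, π (u ++ v) = π u * π v) (u : List A) (n : ℕ) :
    ((u.map some ++ List.replicate n none).map (extendPad π)).prod = π u := by
  induction u with
  | nil => simp [extendPad, hπ_nil]
  | cons a u ih =>
    rw [← List.singleton_append, hπ_mul, ← ih]
    simp [extendPad]

/-- A rule automaton tells the truth: if a finite state automaton `M` over
`A⁺ × A⁺` admits a function `φ` from states to `G` with `φ = 1` on initial and final states,
`φ(t) = π⁺(x)⁻¹ φ(s) π⁺(y)` along each arrow labelled `(x,y)`, and `φ(s) = φ(t)` along each
ε-arrow, then every pair `(u,v)` whose padded word is accepted by `M` satisfies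
`π u = π v` in `G`. -/
theorem stmt11 {A G σ : Type} [Fintype A] [Group G] [Fintype σ]
    (π : List A → G) (hπ_nil : π [] = 1)
    (hπ_mul : ∀ u v : List A, π (u ++ v) = π u * π v)
    (hπ_surj : Function.Surjective π)
    (lab : σ → (Option A × Option A) → σ → Prop) (eps : σ → σ → Prop)
    (init final : Set σ) (hinit : init.Nonempty) (hfinal : final.Nonempty)
    (φ : σ → G)
    (hφ_init : ∀ s ∈ init, φ s = 1) (hφ_final : ∀ s ∈ final, φ s = 1)
    (hφ_lab : ∀ (s t : σ) (x y : Option A), lab s (x, y) t →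
      φ t = (extendPad π x)⁻¹ * φ s * extendPad π y)
    (hφ_eps : ∀ s t : σ, eps s t → φ s = φ t) :
    ∀ u v : List A,
      (∃ s ∈ init, ∃ t ∈ final, EpsPath lab eps s (padPair (u, v)) t) →
      π u = π v := by
  rintro u v ⟨s, hs, t, ht, h⟩
  have key := h.map_eq hφ_lab hφ_eps
  rw [padPair_map_fst, padPair_map_snd, prod_map_extendPad hπ_nil hπ_mul,
    prod_map_extendPad hπ_nil hπ_mul, hφ_init s hs, hφ_final t ht, mul_one] at key
  exact inv_mul_eq_one.mp key.symm
end

section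
/- Suppose A is finite and closed under the involution ι, and suppose there is a set R of rules satisfying the standard assumptions (so that in particular two words u, v satisfy π(u) = π(v) if and only if they are Thue equivalent with respect to R) such that R is regular as a padded language over A⁺ × A⁺. Then the group G is finitely presented: G admits a presentation with finitely many generators and finitely many defining relations. -/
/-- A set of pairs of words over `A` is regular if the corresponding set of padded words is a
regular language over `A⁺ × A⁺`. -/
def PairsRegular {A : Type} (R : Set (List A × List A)) : Prop :=
  Language.IsRegular {w : List (Option A × Option A) | ∃ p ∈ R, w = padPair p}

/-- The element of the free group on `A` spelled by a word over `A`, ignoring padding. -/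
def padProd {A : Type} (w : List (Option A)) : FreeGroup A :=
  (w.map fun o => o.elim 1 FreeGroup.of).prod

/-- The element `u * v⁻¹` of the free group associated to the (padded) pair of words `(u, v)`. -/
def padDiff {A : Type} (w : List (Option A × Option A)) : FreeGroup A :=
  padProd (w.map Prod.fst) * (padProd (w.map Prod.snd))⁻¹

/-- The element of the free group on `A` spelled by a word over `A`. -/
def wordProd {A : Type} (w : List A) : FreeGroup A := (w.map FreeGroup.of).prod

lemma wordProd_append {A : Type} (u v : List A) :
    wordProd (u ++ v) = wordProd u * wordProd v := by
  simp [wordProd]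

lemma padProd_append {A : Type} (u v : List (Option A)) :
    padProd (u ++ v) = padProd u * padProd v := by
  simp [padProd]

lemma padProd_map_some_append_replicate {A : Type} (u : List A) (n : ℕ) :
    padProd (u.map some ++ List.replicate n none) = wordProd u := by
  simp [padProd, wordProd, Function.comp_def]

lemma padDiff_append {A : Type} (u v : List (Option A × Option A)) :
    padDiff (u ++ v) =
      padProd (u.map Prod.fst) * padDiff v * (padProd (u.map Prod.snd))⁻¹ := by
  simp only [padDiff, List.map_append, padProd_append]
  group

lemma padDiff_padPair {A : Type} (p : List A × List A) :
    padDiff (padPair p) = wordProd p.1 * (wordProd p.2)⁻¹ := by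
  unfold padDiff padPair
  rw [List.map_fst_zip (by simp; omega), List.map_snd_zip (by simp; omega),
    padProd_map_some_append_replicate, padProd_map_some_append_replicate]

/-- If a homomorphism from a free group kills `u * v⁻¹` for all padded pairs `(u, v)` in a regular
language, then these elements lie in the normal closure of a finite subset of its kernel. -/
theorem exists_finite_normalClosure_of_isRegular {A G : Type} [Finite A] [Group G]
    (φ : FreeGroup A →* G) (L : Language (Option A × Option A)) (hL : L.IsRegular)
    (hker : ∀ w ∈ L, padDiff w ∈ φ.ker) :
    ∃ S : Set (FreeGroup A), S.Finite ∧ S ⊆ φ.ker ∧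
      ∀ w ∈ L, padDiff w ∈ Subgroup.normalClosure S := by
  classical
  obtain ⟨σ, _, M, rfl⟩ := hL
  have hc : ∃ c : σ → List (Option A × Option A), ∀ s w,
      M.evalFrom s w ∈ M.accept → M.evalFrom s (c s) ∈ M.accept := by
    refine ⟨fun s => if h : ∃ w, M.evalFrom s w ∈ M.accept then h.choose else [], ?_⟩
    intro s w h
    have h' : ∃ w, M.evalFrom s w ∈ M.accept := ⟨w, h⟩
    simpa only [dif_pos h'] using h'.choose_spec
  obtain ⟨c, hc⟩ := hc
  let f : σ × (Option A × Option A) → FreeGroup A := fun q =>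
    padDiff (q.2 :: c (M.step q.1 q.2)) * (padDiff (c q.1))⁻¹
  let g : σ → FreeGroup A := fun s => padDiff (c s)
  let S : Set (FreeGroup A) := (Set.range f ∪ Set.range g) ∩ φ.ker
  have hunique : ∀ v w z, M.eval (v ++ w) ∈ M.accept → M.eval (v ++ z) ∈ M.accept →
      padDiff w * (padDiff z)⁻¹ ∈ φ.ker := by
    intro v w z hw hz
    have h₁ := hker _ hw
    have h₂ := hker _ hz
    rw [padDiff_append, MonoidHom.mem_ker] at h₁ h₂
    simp only [map_mul, map_inv] at h₁ h₂
    rw [MonoidHom.mem_ker, map_mul, map_inv, mul_inv_eq_one]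
    exact mul_left_cancel (mul_right_cancel (h₁.trans h₂.symm))
  have key : ∀ w v, M.eval (v ++ w) ∈ M.accept →
      padDiff w * (padDiff (c (M.eval v)))⁻¹ ∈ Subgroup.normalClosure S := by
    intro w
    induction w with
    | nil =>
      intro v h
      have hcv : M.eval (v ++ c (M.eval v)) ∈ M.accept := by
        rw [DFA.eval, DFA.evalFrom_of_append]
        rw [DFA.eval, DFA.evalFrom_of_append] at h
        exact hc _ _ h
      have hn : padDiff ([] : List (Option A × Option A)) = 1 := by simp [padDiff, padProd]
      have h₁ := hunique v _ _ h hcv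
      rw [hn, one_mul] at h₁ ⊢
      rw [inv_mem_iff] at h₁ ⊢
      exact Subgroup.subset_normalClosure ⟨Or.inr ⟨_, rfl⟩, h₁⟩
    | cons α w ih =>
      intro v h
      have h' : M.eval ((v ++ [α]) ++ w) ∈ M.accept := by simpa using h
      have h₁ := ih _ h'
      have hcv : M.eval (v ++ c (M.eval v)) ∈ M.accept := by
        rw [DFA.eval, DFA.evalFrom_of_append]
        rw [DFA.eval, DFA.evalFrom_of_append] at h
        exact hc _ _ h
      have hcv' : M.eval ((v ++ [α]) ++ c (M.eval (v ++ [α]))) ∈ M.accept := by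
        rw [DFA.eval, DFA.evalFrom_of_append]
        rw [DFA.eval, DFA.evalFrom_of_append] at h'
        exact hc _ _ h'
      rw [DFA.eval_append_singleton] at h₁
      have h₂ := hunique v (α :: c (M.step (M.eval v) α)) _ (by simpa using hcv') hcv
      have h₃ : f (M.eval v, α) ∈ Subgroup.normalClosure S :=
        Subgroup.subset_normalClosure ⟨Or.inl ⟨_, rfl⟩, h₂⟩
      have h₄ := Subgroup.normalClosure_normal.conj_mem _ h₁ (padProd [α.1])
      convert mul_mem h₄ h₃ using 1
      have e : ∀ z, padDiff (α :: z) = padProd [α.1] * padDiff z * (padProd [α.2])⁻¹ :=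
        fun z => padDiff_append [α] z
      simp only [f, e]
      group
  refine ⟨S, ((Set.finite_range f).union (Set.finite_range g)).inter_of_left _,
    Set.inter_subset_right, fun w hw => ?_⟩
  have h₁ := key w [] hw
  have hs : padDiff (c M.start) ∈ Subgroup.normalClosure S :=
    Subgroup.subset_normalClosure ⟨Or.inr ⟨_, rfl⟩, hker _ (hc M.start w hw)⟩
  have h₂ := mul_mem h₁ hs
  simpa using h₂

/-- If every `a⁻¹` agrees modulo the normal subgroup `N` with some generator, then every element
agrees modulo `N` with a positive word. -/
lemma exists_wordProd_mk_eq {A : Type} (N : Subgroup (FreeGroup A)) [N.Normal] (ι : A → A)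
    (hι : ∀ a, FreeGroup.of a * FreeGroup.of (ι a) ∈ N) (x : FreeGroup A) :
    ∃ w : List A, (x : FreeGroup A ⧸ N) = (wordProd w : FreeGroup A) := by
  induction x using FreeGroup.induction_on with
  | C1 => exact ⟨[], rfl⟩
  | of a => exact ⟨[a], by simp [wordProd]⟩
  | inv_of a _ =>
    refine ⟨[ι a], ?_⟩
    rw [QuotientGroup.eq]
    simpa [wordProd] using hι a
  | mul x y hx hy =>
    obtain ⟨u, hu⟩ := hx
    obtain ⟨v, hv⟩ := hy
    exact ⟨u ++ v, by rw [wordProd_append, QuotientGroup.mk_mul, QuotientGroup.mk_mul, hu, hv]⟩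

/-- Thue equivalent words are equal in any quotient in which all rules hold. -/
lemma mk_wordProd_eq_of_eqvGen {A : Type} (N : Subgroup (FreeGroup A)) [N.Normal]
    (R : Set (List A × List A))
    (hR : ∀ p ∈ R, wordProd p.1 * (wordProd p.2)⁻¹ ∈ N) {u v : List A}
    (h : Relation.EqvGen (ElemRed R) u v) :
    ((wordProd u : FreeGroup A) : FreeGroup A ⧸ N) = (wordProd v : FreeGroup A) := by
  induction h with
  | rel u v h =>
    obtain ⟨a, b, l, r, hlr, rfl, rfl⟩ := h
    have h₁ : ((wordProd l : FreeGroup A) : FreeGroup A ⧸ N) = (wordProd r : FreeGroup A) := by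
      rw [← mul_inv_eq_one, ← QuotientGroup.mk_inv, ← QuotientGroup.mk_mul,
        QuotientGroup.eq_one_iff]
      exact hR _ hlr
    simp only [wordProd_append, QuotientGroup.mk_mul, h₁]
  | refl => rfl
  | symm _ _ _ ih => exact ih.symm
  | trans _ _ _ _ _ ih₁ ih₂ => exact ih₁.trans ih₂

/-- If `A` is finite and closed under the inverse involution, and `G` is
determined by a set of rules `R` satisfying the standard assumptions which is regular as a
padded language, then `G` is finitely presented. -/
theorem stmt12 {A G : Type} [Fintype A] [LinearOrder A] [Group G]
    (π : List A → G) (hπ_nil : π [] = 1)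
    (hπ_mul : ∀ u v : List A, π (u ++ v) = π u * π v)
    (hπ_surj : Function.Surjective π)
    (ι : A → A) (hι : Function.Involutive ι)
    (hι_inv : ∀ x : A, π [ι x] = (π [x])⁻¹)
    (R : Set (List A × List A))
    (hstd : StandardAssumptions π R)
    (hreg : PairsRegular R) :
    ∃ (n : ℕ) (rels : Finset (FreeGroup (Fin n))),
      Nonempty (G ≃* PresentedGroup (↑rels : Set (FreeGroup (Fin n)))) := by
  let φ : FreeGroup A →* G := FreeGroup.lift fun a => π [a]
  have hφ : ∀ w, φ (wordProd w) = π w := by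
    intro w
    induction w with
    | nil => simp [wordProd, hπ_nil]
    | cons a w ih =>
      rw [← List.singleton_append, wordProd_append, map_mul, ih, hπ_mul]
      simp [wordProd, φ]
  obtain ⟨S, hSfin, hSker, hS⟩ := exists_finite_normalClosure_of_isRegular φ _ hreg (by
    rintro _ ⟨p, hp, rfl⟩
    rw [padDiff_padPair, MonoidHom.mem_ker, map_mul, map_inv, hφ, hφ, (hstd.1 p hp).2,
      mul_inv_cancel])
  let I : Set (FreeGroup A) := Set.range fun a => FreeGroup.of a * FreeGroup.of (ι a)
  let N := Subgroup.normalClosure (S ∪ I)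
  have hle : N ≤ φ.ker := by
    refine Subgroup.normalClosure_le_normal (Set.union_subset hSker ?_)
    rintro _ ⟨a, rfl⟩
    simp [φ, MonoidHom.mem_ker, hι_inv]
  have hNker : N = φ.ker := by
    refine le_antisymm hle fun x hx => ?_
    obtain ⟨w, hw⟩ := exists_wordProd_mk_eq N ι
      (fun a => Subgroup.subset_normalClosure (Or.inr ⟨a, rfl⟩)) x
    have hw₁ : π w = π [] := by
      have h₁ := hle (QuotientGroup.eq.1 hw)
      rw [MonoidHom.mem_ker, map_mul, map_inv, MonoidHom.mem_ker.1 hx, hφ] at h₁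
      simpa [hπ_nil] using h₁
    have h₂ := mk_wordProd_eq_of_eqvGen N R (fun p hp => by
      rw [← padDiff_padPair]
      exact Subgroup.normalClosure_mono Set.subset_union_left (hS _ ⟨p, hp, rfl⟩))
      ((hstd.2 w []).2 hw₁)
    rw [← QuotientGroup.eq_one_iff, hw, h₂]
    rfl
  have hsurj : Function.Surjective φ := fun x => by
    obtain ⟨w, rfl⟩ := hπ_surj x
    exact ⟨wordProd w, hφ w⟩
  have : Finite ↥(S ∪ I) := (hSfin.union (Set.finite_range _)).to_subtype
  let e : PresentedGroup (S ∪ I) ≃* G := (QuotientGroup.quotientMulEquivOfEq hNker).trans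
    (QuotientGroup.quotientKerEquivOfSurjective φ hsurj)
  have : Group.IsFinitelyPresented G := Group.IsFinitelyPresented.equiv e
  obtain ⟨n, s, hs, h⟩ := Group.IsFinitelyPresented.exists_mulEquiv_presentedGroup (G := G)
  exact ⟨n, hs.toFinset, by rwa [hs.coe_toFinset]⟩
end

section
/- Let N be a nondeterministic finite automaton with ε-transitions (εNFA) over a finite alphabet A with finite state set σ, and let ≤ be a partial order on σ such that: (i) whenever p ≤ q, the language accepted by N with p as its only initial state is contained in the language accepted by N with q as its only initial state; and (ii) whenever p < q, p' < q', and p' lies in the ε-closure of {q}, then p' = q. Let prune : Set σ → Set σ be any function satisfying prune(S) ⊆ S and, for every p ∈ S, there exists q ∈ prune(S) with p ≤ q. Define a deterministic automaton M' on subsets of σ by: initial state prune(εClosure of the set of initial states of N); transition on letter x from state S given by prune(εClosure of the set of all x-successors of elements of S); and accepting states those S containing a final state of N. Then the language accepted by M' equals the language accepted by N. -/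
theorem NFA.mem_acceptsFrom_iff_exists {α σ : Type*} (M : NFA α σ) {S : Set σ} {w : List α} :
    w ∈ M.acceptsFrom S ↔ ∃ s ∈ S, w ∈ M.acceptsFrom {s} := by
  simp only [NFA.mem_acceptsFrom]
  constructor
  · rintro ⟨t, ht, h⟩
    obtain ⟨s, hs, h⟩ := NFA.mem_evalFrom_iff_exists.1 h
    exact ⟨s, hs, t, ht, h⟩
  · rintro ⟨s, hs, t, ht, h⟩
    exact ⟨t, ht, NFA.mem_evalFrom_iff_exists.2 ⟨s, hs, h⟩⟩

namespace εNFA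

variable {α σ : Type*} (M : εNFA α σ)

theorem εClosure_mono {S T : Set σ} (h : S ⊆ T) : M.εClosure S ⊆ M.εClosure T := by
  intro s hs
  induction hs with
  | base s hs => exact .base s (h hs)
  | step s t ht _ ih => exact εClosure.step s t ht ih

theorem εClosure_idem (S : Set σ) : M.εClosure (M.εClosure S) = M.εClosure S := by
  refine Set.Subset.antisymm (fun s hs ↦ ?_) (M.subset_εClosure _)
  induction hs with
  | base s hs => exact hs
  | step s t ht _ ih => exact εClosure.step s t ht ih

theorem εClosure_biUnion {ι : Type*} (I : Set ι) (f : ι → Set σ) :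
    M.εClosure (⋃ i ∈ I, f i) = ⋃ i ∈ I, M.εClosure (f i) := by
  ext s
  simp only [Set.mem_iUnion₂]
  constructor
  · intro hs
    induction hs with
    | base s hs =>
      obtain ⟨i, hi, hs⟩ := Set.mem_iUnion₂.1 hs
      exact ⟨i, hi, .base s hs⟩
    | step s t ht _ ih =>
      obtain ⟨i, hi, hs⟩ := ih
      exact ⟨i, hi, εClosure.step s t ht hs⟩
  · rintro ⟨i, hi, hs⟩
    exact M.εClosure_mono (Set.subset_biUnion_of_mem hi) hs

theorem εClosure_with_start (T S : Set σ) :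
    ({ M with start := T } : εNFA α σ).εClosure S = M.εClosure S := by
  ext s
  constructor <;> intro hs <;> induction hs with
  | base s hs => exact .base s hs
  | step s t ht _ ih => exact εClosure.step s t ht ih

theorem accepts_with_start (T : Set σ) :
    ({ M with start := T } : εNFA α σ).accepts = M.toNFA.acceptsFrom (M.εClosure T) := by
  have h : ({ M with start := T } : εNFA α σ).toNFA =
      { M.toNFA with start := M.εClosure T } := by
    simp only [toNFA, εClosure_with_start]
  rw [← toNFA_correct, h]
  rfl

/-- Replacing an ε-closed set by a dominating subset does not change the accepted language,
provided that the ε-moves out of a strictly larger state do not lead to another strictly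
dominated state. -/
theorem acceptsFrom_toNFA_of_dominating [PartialOrder σ]
    (hmono : ∀ p q : σ, p ≤ q →
      M.toNFA.acceptsFrom (M.εClosure {p}) ≤ M.toNFA.acceptsFrom (M.εClosure {q}))
    (hclos : ∀ p q p' q' : σ, p < q → p' < q' → p' ∈ M.εClosure {q} → p' = q)
    {S T : Set σ} (hS : M.εClosure S = S) (hTS : T ⊆ S) (hdom : ∀ p ∈ S, ∃ q ∈ T, p ≤ q) :
    M.toNFA.acceptsFrom T = M.toNFA.acceptsFrom S := by
  ext w
  constructor
  · exact fun hw ↦ M.toNFA.mem_acceptsFrom_iff_exists.2 <|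
      let ⟨t, ht, hw⟩ := M.toNFA.mem_acceptsFrom_iff_exists.1 hw
      ⟨t, hTS ht, hw⟩
  · intro hw
    obtain ⟨p, hp, hpw⟩ := M.toNFA.mem_acceptsFrom_iff_exists.1 hw
    obtain ⟨q, hq, hpq⟩ := hdom p hp
    rcases hpq.eq_or_lt with rfl | hlt
    · exact M.toNFA.mem_acceptsFrom_iff_exists.2 ⟨p, hq, hpw⟩
    have hqw : w ∈ M.toNFA.acceptsFrom (M.εClosure {q}) :=
      hmono p q hpq (M.toNFA.mem_acceptsFrom_iff_exists.2 ⟨p, .base p rfl, hpw⟩)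
    obtain ⟨p', hp', hpw'⟩ := M.toNFA.mem_acceptsFrom_iff_exists.1 hqw
    have hp'S : p' ∈ S :=
      hS ▸ M.εClosure_mono (Set.singleton_subset_iff.2 (hTS hq)) hp'
    obtain ⟨q', hq', hpq'⟩ := hdom p' hp'S
    rcases hpq'.eq_or_lt with rfl | hlt'
    · exact M.toNFA.mem_acceptsFrom_iff_exists.2 ⟨p', hq', hpw'⟩
    · obtain rfl := hclos p q p' q' hlt hlt' hp'
      exact M.toNFA.mem_acceptsFrom_iff_exists.2 ⟨p', hq, hpw'⟩

end εNFA


/-- A modified subset construction. Let `N` be an εNFA over a finite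
alphabet with finite state set carrying a partial order `≤` such that `p ≤ q` implies
`L(N_p) ⊆ L(N_q)` (where `N_p` is `N` with `p` as only initial state), and such that if
`p < q`, `p' < q'` and `p'` is in the ε-closure of `{q}`, then `p' = q`. Let `prune` be any
function on subsets of states with `prune S ⊆ S` and such that every `p ∈ S` is dominated
by some `q ∈ prune S`. Then the DFA obtained from the subset construction, applying `prune`
to the initial ε-closed subset and after each transition, accepts exactly `L(N)`. -/
theorem stmt13 {A σ : Type} [Fintype A] [Fintype σ] [PartialOrder σ]
    (N : εNFA A σ)
    (hmono : ∀ p q : σ, p ≤ q → ∀ w : List A,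
      w ∈ ({ N with start := {p} } : εNFA A σ).accepts →
      w ∈ ({ N with start := {q} } : εNFA A σ).accepts)
    (hclos : ∀ p q p' q' : σ, p < q → p' < q' → p' ∈ N.εClosure {q} → p' = q)
    (prune : Set σ → Set σ)
    (hprune_sub : ∀ S : Set σ, prune S ⊆ S)
    (hprune_dom : ∀ S : Set σ, ∀ p ∈ S, ∃ q ∈ prune S, p ≤ q) :
    (DFA.mk
      (fun (S : Set σ) (x : A) => prune (N.εClosure (⋃ s ∈ S, N.step s (some x))))
      (prune (N.εClosure N.start))
      {S : Set σ | ∃ s ∈ S, s ∈ N.accept}).accepts = N.accepts := by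
  have key (U : Set σ) : N.toNFA.acceptsFrom (prune (N.εClosure U)) =
      N.toNFA.acceptsFrom (N.εClosure U) := by
    refine N.acceptsFrom_toNFA_of_dominating (fun p q hpq w hw ↦ ?_) hclos
      (N.εClosure_idem U) (hprune_sub _) (hprune_dom _)
    have h := hmono p q hpq w
    rw [N.accepts_with_start, N.accepts_with_start] at h
    exact h hw
  set D := DFA.mk
      (fun (S : Set σ) (x : A) => prune (N.εClosure (⋃ s ∈ S, N.step s (some x))))
      (prune (N.εClosure N.start))
      {S : Set σ | ∃ s ∈ S, s ∈ N.accept}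
  have main (w : List A) (S : Set σ) :
      w ∈ D.acceptsFrom S ↔ w ∈ N.toNFA.acceptsFrom S := by
    induction w generalizing S with
    | nil => exact (N.toNFA.nil_mem_acceptsFrom).symm
    | cons x w ih =>
      rw [NFA.cons_mem_acceptsFrom]
      change w ∈ D.acceptsFrom (prune (N.εClosure (⋃ s ∈ S, N.step s (some x)))) ↔ _
      rw [ih, key, N.εClosure_biUnion]
      rfl
  ext w
  change w ∈ D.acceptsFrom (prune (N.εClosure N.start)) ↔
    w ∈ N.toNFA.acceptsFrom (N.εClosure N.start)
  rw [main, key]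
end
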